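/- arXiv:math/0301131 — 8 statements merged into one kernel-verified Lean document; each statement's English description precedes it below -/
import Mathlib

section
/- Let V and W be finite-dimensional complex inner product spaces, let a be a self-adjoint endomorphism of V and b a self-adjoint endomorphism of W, and let T be the endomorphism of Hom(V, W) defined by T(h) = b ∘ h − h ∘ a. Then for every y ∈ ℝ and every h ∈ Hom(V, W), one has T(h) = y·h if and only if for every λ ∈ ℝ, h maps ker(a − λ·id_V) into ker(b − (λ + y)·id_W). In particular every eigenvalue of T is a difference η − λ of an eigenvalue η of b and an eigenvalue λ of a. -/
open LinearMap Module

noncomputable section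

/-- Let `a`, `b` be self-adjoint endomorphisms of the finite-dimensional
complex inner product spaces `V`, `W`, and let `T : Hom(V,W) → Hom(V,W)` be given by
`T h = b ∘ h − h ∘ a`.  Then for `y ∈ ℝ` and `h`, `T h = y • h` iff for every `λ ∈ ℝ`,
`h` maps `ker (a − λ·id)` into `ker (b − (λ+y)·id)`.  In particular every eigenvalue of
`T` is a difference `η − λ` of an eigenvalue `η` of `b` and an eigenvalue `λ` of `a`. -/
theorem hom_endomorphism_eigen_decomposition
    {V W : Type*} [NormedAddCommGroup V] [InnerProductSpace ℂ V] [FiniteDimensional ℂ V]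
    [NormedAddCommGroup W] [InnerProductSpace ℂ W] [FiniteDimensional ℂ W]
    (a : V →ₗ[ℂ] V) (b : W →ₗ[ℂ] W) (ha : a.IsSymmetric) (hb : b.IsSymmetric)
    (T : (V →ₗ[ℂ] W) →ₗ[ℂ] (V →ₗ[ℂ] W))
    (hT : ∀ h : V →ₗ[ℂ] W, T h = b ∘ₗ h - h ∘ₗ a) :
    (∀ (y : ℝ) (h : V →ₗ[ℂ] W),
      T h = (y : ℂ) • h ↔
        ∀ (lam : ℝ) (v : V), v ∈ LinearMap.ker (a - (lam : ℂ) • LinearMap.id) →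
          h v ∈ LinearMap.ker (b - ((lam : ℂ) + (y : ℂ)) • LinearMap.id)) ∧
    (∀ μ : ℂ, Module.End.HasEigenvalue (T : Module.End ℂ (V →ₗ[ℂ] W)) μ →
      ∃ η lam : ℂ, Module.End.HasEigenvalue (b : Module.End ℂ W) η ∧
        Module.End.HasEigenvalue (a : Module.End ℂ V) lam ∧ μ = η - lam) := by
  set e := ha.eigenvectorBasis rfl with he
  have hae : ∀ i, a (e i) = ((ha.eigenvalues rfl i : ℝ) : ℂ) • e i := fun i =>
    ha.apply_eigenvectorBasis rfl i
  refine ⟨fun y h => ⟨fun hh lam v hv => ?_, fun hh => ?_⟩, fun μ hμ => ?_⟩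
  · have h1 := LinearMap.congr_fun ((hT h).symm.trans hh) v
    simp only [LinearMap.mem_ker, LinearMap.sub_apply, LinearMap.smul_apply, LinearMap.id_apply,
      LinearMap.comp_apply, sub_eq_zero] at hv h1 ⊢
    rw [hv, map_smul, sub_eq_iff_eq_add] at h1
    rw [h1, add_smul, add_comm]
  · refine e.toBasis.ext fun i => ?_
    have h1 := hh (ha.eigenvalues rfl i) (e i) (by simp [hae i])
    simp only [LinearMap.mem_ker, LinearMap.sub_apply, LinearMap.smul_apply, LinearMap.id_apply,
      sub_eq_zero] at h1
    rw [hT, OrthonormalBasis.coe_toBasis]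
    simp only [LinearMap.sub_apply, LinearMap.smul_apply, LinearMap.comp_apply]
    rw [h1, hae i, map_smul, add_smul, add_sub_cancel_left]
  · obtain ⟨h, hh⟩ := hμ.exists_hasEigenvector
    have hne : ∃ i, h (e i) ≠ 0 := by
      by_contra! hc
      exact hh.2 (e.toBasis.ext fun i => by simpa using hc i)
    obtain ⟨i, hi⟩ := hne
    have h1 := LinearMap.congr_fun ((hT h).symm.trans hh.apply_eq_smul) (e i)
    simp only [LinearMap.sub_apply, LinearMap.smul_apply, LinearMap.comp_apply] at h1
    rw [hae i, map_smul, sub_eq_iff_eq_add] at h1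
    refine ⟨μ + (ha.eigenvalues rfl i : ℝ), (ha.eigenvalues rfl i : ℝ), ?_, ?_, by ring⟩
    · exact Module.End.hasEigenvalue_of_hasEigenvector (x := h (e i))
        ⟨Module.End.mem_eigenspace_iff.2 (by rw [h1, add_smul]), hi⟩
    · exact ha.hasEigenvalue_eigenvalues rfl i
end
end

section
/- (Proposition 1.1(1)) Assume t = (t_1, …, t_m) ∈ ℝ^m with t_i > 0 for all i. Then for a tuple f = (f_1, …, f_m) of linear maps f_i : V_i → V_{i+1}, the following are equivalent: (a) f is μ_t-semistable; (b) f is μ_t-stable; (c) all the maps f_i are injective. -/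
open LinearMap Module Submodule

noncomputable section

/-- The sum of the eigenspaces of `ξ` for (real) eigenvalues `≤ lam`. -/
def eigFilt {V : Type*} [NormedAddCommGroup V] [InnerProductSpace ℂ V]
    (ξ : V →ₗ[ℂ] V) (lam : ℝ) : Submodule ℂ V :=
  ⨆ (μ : ℝ) (_ : μ ≤ lam), Module.End.eigenspace (ξ : Module.End ℂ V) (μ : ℂ)

/-- The spectral condition on `(f, ξ)`.  Here the tuple `ξ = (ξ_1, …, ξ_m)` of
endomorphisms of `V_1, …, V_m` is encoded as a tuple indexed by `Fin (m+1)` whose last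
component is required to be `0`.  The condition `f i (V_{i,λ}) ⊆ V_{i+1,λ}` for
`1 ≤ i ≤ m−1` together with the vanishing of `f_m` on the sum of the eigenspaces of
`ξ_m` for negative eigenvalues is then expressed uniformly, since the `≤ λ`
eigenspace-sum of the zero endomorphism is `⊥` for `λ < 0` and `⊤` for `λ ≥ 0`. -/
def SpectralCond {m : ℕ} {V : Fin (m + 1) → Type*} [∀ j, NormedAddCommGroup (V j)]
    [∀ j, InnerProductSpace ℂ (V j)]
    (f : ∀ i : Fin m, V i.castSucc →ₗ[ℂ] V i.succ)
    (ξ : ∀ j, V j →ₗ[ℂ] V j) : Prop :=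
  ξ (Fin.last m) = 0 ∧
    ∀ (i : Fin m) (lam : ℝ),
      (eigFilt (ξ i.castSucc) lam).map (f i) ≤ eigFilt (ξ i.succ) lam

/-- `μ_t`-stability of a tuple `f = (f_1, …, f_m)`: for every nonzero tuple of
self-adjoint endomorphisms satisfying the spectral condition, `Σ_i t_i Tr(ξ_i) > 0`. -/
def MuStable {m : ℕ} {V : Fin (m + 1) → Type*} [∀ j, NormedAddCommGroup (V j)]
    [∀ j, InnerProductSpace ℂ (V j)] [∀ j, FiniteDimensional ℂ (V j)]
    (t : Fin m → ℝ) (f : ∀ i : Fin m, V i.castSucc →ₗ[ℂ] V i.succ) : Prop :=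
  ∀ ξ : ∀ j, V j →ₗ[ℂ] V j, (∀ j, (ξ j).IsSymmetric) → SpectralCond f ξ → ξ ≠ 0 →
    0 < ∑ i : Fin m, t i * (LinearMap.trace ℂ (V i.castSucc) (ξ i.castSucc)).re

/-- `μ_t`-semistability of a tuple `f = (f_1, …, f_m)`. -/
def MuSemistable {m : ℕ} {V : Fin (m + 1) → Type*} [∀ j, NormedAddCommGroup (V j)]
    [∀ j, InnerProductSpace ℂ (V j)] [∀ j, FiniteDimensional ℂ (V j)]
    (t : Fin m → ℝ) (f : ∀ i : Fin m, V i.castSucc →ₗ[ℂ] V i.succ) : Prop :=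
  ∀ ξ : ∀ j, V j →ₗ[ℂ] V j, (∀ j, (ξ j).IsSymmetric) → SpectralCond f ξ → ξ ≠ 0 →
    0 ≤ ∑ i : Fin m, t i * (LinearMap.trace ℂ (V i.castSucc) (ξ i.castSucc)).re

lemma eigFilt_zero_neg {W : Type*} [NormedAddCommGroup W] [InnerProductSpace ℂ W]
    {lam : ℝ} (h : lam < 0) : eigFilt (0 : W →ₗ[ℂ] W) lam = ⊥ := by
  rw [eq_bot_iff]
  refine iSup₂_le fun μ hμ v hv => ?_
  rw [Module.End.mem_eigenspace_iff] at hv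
  have h0 : (μ : ℂ) ≠ 0 := by
    exact_mod_cast (lt_of_le_of_lt hμ h).ne
  have : (μ : ℂ) • v = 0 := by simpa using hv.symm
  exact (smul_eq_zero.1 this).resolve_left h0

lemma eigFilt_zero_nonneg {W : Type*} [NormedAddCommGroup W] [InnerProductSpace ℂ W]
    {lam : ℝ} (h : 0 ≤ lam) : eigFilt (0 : W →ₗ[ℂ] W) lam = ⊤ := by
  rw [eq_top_iff]
  refine le_trans ?_ (le_iSup₂_of_le (0 : ℝ) h le_rfl)
  intro v _
  rw [Module.End.mem_eigenspace_iff]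
  simp

/-- Minus the orthogonal projection on `K`. -/
def negProj {W : Type*} [NormedAddCommGroup W] [InnerProductSpace ℂ W] [FiniteDimensional ℂ W]
    (K : Submodule ℂ W) : W →ₗ[ℂ] W := -(K.starProjection : W →L[ℂ] W).toLinearMap

lemma negProj_neg {W : Type*} [NormedAddCommGroup W] [InnerProductSpace ℂ W]
    [FiniteDimensional ℂ W] (K : Submodule ℂ W)
    {lam : ℝ} (h : lam < 0) : eigFilt (negProj K) lam ≤ K := by
  refine iSup₂_le fun μ hμ v hv => ?_
  rw [Module.End.mem_eigenspace_iff] at hv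
  have h0 : (μ : ℂ) ≠ 0 := by
    exact_mod_cast (lt_of_le_of_lt hμ h).ne
  have h1 : (μ : ℂ) • v ∈ K := by
    rw [← hv]
    simp only [negProj, LinearMap.neg_apply]
    exact K.neg_mem (K.starProjection_apply_mem v)
  exact (K.smul_mem_iff h0).1 h1

lemma negProj_nonneg {W : Type*} [NormedAddCommGroup W] [InnerProductSpace ℂ W]
    [FiniteDimensional ℂ W] (K : Submodule ℂ W)
    {lam : ℝ} (h : 0 ≤ lam) : eigFilt (negProj K) lam = ⊤ := by
  rw [eq_top_iff]
  intro v _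
  have e : v = K.starProjection v + (v - K.starProjection v) := by abel
  have hP : K.starProjection (K.starProjection v) = K.starProjection v :=
    K.starProjection_eq_self_iff.2 (K.starProjection_apply_mem v)
  rw [e]
  refine Submodule.add_mem _ ?_ ?_
  · refine (le_iSup₂_of_le (f := fun (μ : ℝ) (_ : μ ≤ lam) =>
      Module.End.eigenspace (negProj K : Module.End ℂ W) (μ : ℂ)) (-1 : ℝ) (by linarith) le_rfl) ?_
    rw [Module.End.mem_eigenspace_iff]
    simp [negProj, hP]
  · refine (le_iSup₂_of_le (f := fun (μ : ℝ) (_ : μ ≤ lam) =>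
      Module.End.eigenspace (negProj K : Module.End ℂ W) (μ : ℂ)) (0 : ℝ) h le_rfl) ?_
    rw [Module.End.mem_eigenspace_iff]
    simp [negProj, hP]

lemma negProj_symm {W : Type*} [NormedAddCommGroup W] [InnerProductSpace ℂ W]
    [FiniteDimensional ℂ W] (K : Submodule ℂ W) : (negProj K).IsSymmetric := by
  intro x y
  simp only [negProj, LinearMap.neg_apply, inner_neg_left, inner_neg_right]
  rw [K.starProjection_isSymmetric x y]

lemma negProj_trace {W : Type*} [NormedAddCommGroup W] [InnerProductSpace ℂ W]
    [FiniteDimensional ℂ W] (K : Submodule ℂ W) :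
    (LinearMap.trace ℂ W (negProj K)).re = -(Module.finrank ℂ K : ℝ) := by
  have hp : LinearMap.IsProj K (K.starProjection : W →L[ℂ] W).toLinearMap :=
    ⟨fun x => K.starProjection_apply_mem x, fun x hx => K.starProjection_eq_self_iff.2 hx⟩
  rw [negProj, map_neg, hp.trace]
  simp

lemma trace_pos_aux {W : Type*} [NormedAddCommGroup W] [InnerProductSpace ℂ W]
    [FiniteDimensional ℂ W] {T : W →ₗ[ℂ] W} (hT : T.IsSymmetric)
    (h : ∀ lam : ℝ, lam < 0 → eigFilt T lam = ⊥) :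
    0 ≤ (LinearMap.trace ℂ W T).re ∧ (T ≠ 0 → 0 < (LinearMap.trace ℂ W T).re) := by
  have key : (LinearMap.trace ℂ W T).re = ∑ i, hT.eigenvalues rfl i :=
    hT.re_trace_eq_sum_eigenvalues rfl
  have hnn : ∀ i, 0 ≤ hT.eigenvalues rfl i := by
    intro i
    by_contra hneg
    push Not at hneg
    have hmem : hT.eigenvectorBasis rfl i ∈ eigFilt T (hT.eigenvalues rfl i) := by
      refine (le_iSup₂_of_le (f := fun (μ : ℝ) (_ : μ ≤ hT.eigenvalues rfl i) =>
        Module.End.eigenspace (T : Module.End ℂ W) (μ : ℂ)) _ le_rfl le_rfl) ?_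
      rw [Module.End.mem_eigenspace_iff]
      exact hT.apply_eigenvectorBasis rfl i
    rw [h _ hneg, Submodule.mem_bot] at hmem
    exact (hT.eigenvectorBasis rfl).orthonormal.ne_zero i hmem
  rw [key]
  refine ⟨Finset.sum_nonneg fun i _ => hnn i, fun hne => ?_⟩
  refine lt_of_le_of_ne (Finset.sum_nonneg fun i _ => hnn i) fun h0 => hne ?_
  have hz := (Finset.sum_eq_zero_iff_of_nonneg (fun i _ => hnn i)).1 h0.symm
  refine (hT.eigenvectorBasis rfl).toBasis.ext fun i => ?_
  rw [OrthonormalBasis.coe_toBasis, hT.apply_eigenvectorBasis, hz i (Finset.mem_univ i)]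
  simp

lemma stable_of_inj {m : ℕ} {V : Fin (m + 1) → Type*}
    [∀ j, NormedAddCommGroup (V j)] [∀ j, InnerProductSpace ℂ (V j)]
    [∀ j, FiniteDimensional ℂ (V j)]
    (t : Fin m → ℝ) (ht : ∀ i, 0 < t i)
    (f : ∀ i : Fin m, V i.castSucc →ₗ[ℂ] V i.succ)
    (hf : ∀ i, Function.Injective (f i)) : MuStable t f := by
  intro ξ hs hc hne
  have hbot : ∀ j, ∀ lam : ℝ, lam < 0 → eigFilt (ξ j) lam = ⊥ := by
    intro j
    induction j using Fin.reverseInduction with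
    | last => intro lam h; rw [hc.1]; exact eigFilt_zero_neg h
    | cast i ih =>
      intro lam h
      have h1 := hc.2 i lam
      rw [ih lam h, le_bot_iff] at h1
      exact Submodule.map_injective_of_injective (hf i) (h1.trans (Submodule.map_bot (f i)).symm)
  have hp := fun j => trace_pos_aux (hs j) (hbot j)
  obtain ⟨j, hj⟩ := Function.ne_iff.1 hne
  have hjl : j ≠ Fin.last m := by
    rintro rfl
    exact hj hc.1
  obtain ⟨i, rfl⟩ := Fin.exists_castSucc_eq.2 hjl
  exact Finset.sum_pos' (fun i _ => mul_nonneg (ht i).le (hp _).1)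
    ⟨i, Finset.mem_univ i, mul_pos (ht i) ((hp _).2 hj)⟩

lemma inj_of_semistable {m : ℕ} {V : Fin (m + 1) → Type*}
    [∀ j, NormedAddCommGroup (V j)] [∀ j, InnerProductSpace ℂ (V j)]
    [∀ j, FiniteDimensional ℂ (V j)]
    (t : Fin m → ℝ) (ht : ∀ i, 0 < t i)
    (f : ∀ i : Fin m, V i.castSucc →ₗ[ℂ] V i.succ)
    (h : MuSemistable t f) (i : Fin m) : Function.Injective (f i) := by
  rw [← LinearMap.ker_eq_bot]
  by_contra hK
  have hfr : 0 < (Module.finrank ℂ (LinearMap.ker (f i)) : ℝ) := by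
    have : Module.finrank ℂ (LinearMap.ker (f i)) ≠ 0 := by
      rwa [Ne, Submodule.finrank_eq_zero]
    exact_mod_cast Nat.pos_of_ne_zero this
  let ξ : ∀ j, V j →ₗ[ℂ] V j :=
    Function.update (fun _ => 0) i.castSucc (negProj (LinearMap.ker (f i)))
  have hi : ξ i.castSucc = negProj (LinearMap.ker (f i)) := Function.update_self ..
  have ho : ∀ j, j ≠ i.castSucc → ξ j = 0 := fun j hj => Function.update_of_ne hj ..
  have hsum : ∑ k : Fin m, t k * (LinearMap.trace ℂ (V k.castSucc) (ξ k.castSucc)).re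
      = -(t i * Module.finrank ℂ (LinearMap.ker (f i))) := by
    rw [Finset.sum_eq_single i]
    · rw [hi, negProj_trace]; ring
    · intro k _ hk
      rw [ho _ (fun e => hk (Fin.castSucc_injective m e))]
      simp
    · simp
  have hle := h ξ ?_ ⟨?_, ?_⟩ ?_
  · rw [hsum] at hle
    have := mul_pos (ht i) hfr
    linarith
  · intro j
    by_cases hj : j = i.castSucc
    · subst hj; rw [hi]; exact negProj_symm _
    · rw [ho j hj]; exact LinearMap.IsSymmetric.zero
  · exact ho _ (Fin.castSucc_lt_last i).ne'
  · intro k lam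
    rcases lt_or_ge lam 0 with hl | hl
    · by_cases hk : k = i
      · subst hk
        rw [hi]
        refine (Submodule.map_mono (negProj_neg _ hl)).trans ?_
        rw [Submodule.map_le_iff_le_comap]
        intro v hv
        rw [Submodule.mem_comap, LinearMap.mem_ker.1 hv]
        exact Submodule.zero_mem _
      · rw [ho _ (fun e => hk (Fin.castSucc_injective m e)), eigFilt_zero_neg hl]
        simp
    · have : eigFilt (ξ k.succ) lam = ⊤ := by
        by_cases hj : k.succ = i.castSucc
        · rw [hj, hi]; exact negProj_nonneg _ hl
        · rw [ho _ hj]; exact eigFilt_zero_nonneg hl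
      rw [this]
      exact le_top
  · intro h0
    have h1 := negProj_trace (LinearMap.ker (f i))
    rw [← hi, h0] at h1
    simp at h1
    exact hK (by simpa using h1)

/-- **Proposition 1.1(1).** If `t_i > 0` for all `i`, then for a tuple
`f = (f_1, …, f_m)` of linear maps `f_i : V_i → V_{i+1}` the following are equivalent:
`f` is `μ_t`-semistable; `f` is `μ_t`-stable; all the maps `f_i` are injective. -/
theorem muStable_iff_injective {m : ℕ} (hm : 1 ≤ m) {V : Fin (m + 1) → Type*}
    [∀ j, NormedAddCommGroup (V j)] [∀ j, InnerProductSpace ℂ (V j)]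
    [∀ j, FiniteDimensional ℂ (V j)]
    (t : Fin m → ℝ) (ht : ∀ i, 0 < t i)
    (f : ∀ i : Fin m, V i.castSucc →ₗ[ℂ] V i.succ) :
    (MuSemistable t f ↔ MuStable t f) ∧
      (MuStable t f ↔ ∀ i, Function.Injective (f i)) := by
  exact ⟨⟨fun h => stable_of_inj t ht f (inj_of_semistable t ht f h),
    fun h ξ hs hc hne => (h ξ hs hc hne).le⟩,
    ⟨fun h => inj_of_semistable t ht f (fun ξ hs hc hne => (h ξ hs hc hne).le),
    stable_of_inj t ht f⟩⟩
end
end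

section
/- Let f = (f_1, …, f_m) be a tuple of injective linear maps f_i : V_i → V_{i+1}, and let ξ = (ξ_1, …, ξ_m) be a tuple of self-adjoint endomorphisms ξ_i of V_i such that (f, ξ) satisfies the spectral condition. Then every ξ_i is positive semidefinite, i.e. all eigenvalues of every ξ_i are ≥ 0; consequently, if ξ ≠ 0 and t_i > 0 for all i, then Σ_i t_i Tr(ξ_i) > 0. -/
open LinearMap Module Submodule

noncomputable section

theorem eigFilt_eq_bot {m : ℕ} {V : Fin (m + 1) → Type*}
    [∀ j, NormedAddCommGroup (V j)] [∀ j, InnerProductSpace ℂ (V j)]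
    (f : ∀ i : Fin m, V i.castSucc →ₗ[ℂ] V i.succ)
    (hf : ∀ i, Function.Injective (f i))
    (ξ : ∀ j, V j →ₗ[ℂ] V j)
    (hspec : SpectralCond f ξ) (lam : ℝ) (hl : lam < 0) (j : Fin (m + 1)) :
    eigFilt (ξ j) lam = ⊥ := by
  induction j using Fin.reverseInduction with
  | last =>
    rw [hspec.1, eigFilt, iSup_eq_bot]
    intro μ
    rw [iSup_eq_bot]
    intro hμ
    rw [Submodule.eq_bot_iff]
    intro x hx
    rw [Module.End.mem_eigenspace_iff] at hx
    have hne : (μ : ℂ) ≠ 0 := by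
      have : μ ≠ 0 := (lt_of_le_of_lt hμ hl).ne
      exact_mod_cast this
    have h0 : (μ : ℂ) • x = 0 := by rw [← hx]; rfl
    exact (smul_eq_zero.mp h0).resolve_left hne
  | cast i ih =>
    have h := hspec.2 i lam
    rw [ih, le_bot_iff] at h
    exact Submodule.map_injective_of_injective (hf i) (by rw [h, Submodule.map_bot])

theorem trace_re_pos_or {E : Type*} [NormedAddCommGroup E] [InnerProductSpace ℂ E]
    [FiniteDimensional ℂ E] (T : E →ₗ[ℂ] E) (hT : T.IsSymmetric)
    (h : ∀ μ : ℝ, Module.End.HasEigenvalue (T : Module.End ℂ E) (μ : ℂ) → 0 ≤ μ) :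
    0 ≤ (LinearMap.trace ℂ E T).re ∧ ((LinearMap.trace ℂ E T).re = 0 → T = 0) := by
  have hn : ∀ i, 0 ≤ hT.eigenvalues rfl i := fun i =>
    h _ (hT.hasEigenvalue_eigenvalues rfl i)
  have ht : (LinearMap.trace ℂ E T).re = ∑ i, hT.eigenvalues rfl i :=
    hT.re_trace_eq_sum_eigenvalues rfl
  rw [ht]
  refine ⟨Finset.sum_nonneg fun i _ => hn i, fun h0 => ?_⟩
  rw [Finset.sum_eq_zero_iff_of_nonneg fun i _ => hn i] at h0
  refine (hT.eigenvectorBasis rfl).toBasis.ext fun i => ?_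
  have := hT.apply_eigenvectorBasis rfl i
  rw [h0 i (Finset.mem_univ i)] at this
  simpa using this

/-- If all the maps `f_i` are injective and `(f, ξ)` satisfies the
spectral condition with each `ξ_i` self-adjoint, then every `ξ_i` is positive
semidefinite (all its eigenvalues are `≥ 0`); consequently, if `ξ ≠ 0` and `t_i > 0`
for all `i`, then `Σ_i t_i Tr(ξ_i) > 0`. -/
theorem spectralCond_nonneg_eigenvalues {m : ℕ} (hm : 1 ≤ m) {V : Fin (m + 1) → Type*}
    [∀ j, NormedAddCommGroup (V j)] [∀ j, InnerProductSpace ℂ (V j)]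
    [∀ j, FiniteDimensional ℂ (V j)]
    (f : ∀ i : Fin m, V i.castSucc →ₗ[ℂ] V i.succ)
    (hf : ∀ i, Function.Injective (f i))
    (ξ : ∀ j, V j →ₗ[ℂ] V j) (hsym : ∀ j, (ξ j).IsSymmetric)
    (hspec : SpectralCond f ξ) :
    (∀ (i : Fin m) (μ : ℝ),
        Module.End.HasEigenvalue (ξ i.castSucc : Module.End ℂ (V i.castSucc)) (μ : ℂ) →
          0 ≤ μ) ∧
      (∀ t : Fin m → ℝ, (∀ i, 0 < t i) → ξ ≠ 0 →
        0 < ∑ i : Fin m, t i * (LinearMap.trace ℂ (V i.castSucc) (ξ i.castSucc)).re) := by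
  have hE : ∀ (i : Fin m) (μ : ℝ),
        Module.End.HasEigenvalue (ξ i.castSucc : Module.End ℂ (V i.castSucc)) (μ : ℂ) →
          0 ≤ μ := by
    intro i μ hμ
    by_contra hlt
    have hb := eigFilt_eq_bot f hf ξ hspec μ (not_le.mp hlt) i.castSucc
    apply hμ
    rw [eq_bot_iff, ← hb]
    exact le_iSup₂_of_le μ le_rfl le_rfl
  refine ⟨hE, fun t ht hξ => ?_⟩
  have hp := fun i : Fin m => trace_re_pos_or (ξ i.castSucc) (hsym _) (hE i)
  have hnn : ∀ i ∈ Finset.univ, 0 ≤ t i *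
      (LinearMap.trace ℂ (V i.castSucc) (ξ i.castSucc)).re :=
    fun i _ => mul_nonneg (ht i).le (hp i).1
  refine lt_of_le_of_ne (Finset.sum_nonneg hnn) fun h0 => hξ ?_
  have h1 := (Finset.sum_eq_zero_iff_of_nonneg hnn).mp h0.symm
  funext j
  induction j using Fin.lastCases with
  | last => exact hspec.1
  | cast i =>
    exact (hp i).2 ((mul_eq_zero.mp (h1 i (Finset.mem_univ i))).resolve_left (ht i).ne')
end
end

section
/- Let f = (f_1, …, f_m) be a tuple of linear maps f_i : V_i → V_{i+1} and suppose ker(f_i) ≠ 0 for some index i. Define ξ_i := −P, where P is the orthogonal projection of V_i onto ker(f_i), and ξ_j := 0 for all j ≠ i. Then ξ = (ξ_1, …, ξ_m) is a nonzero tuple of self-adjoint endomorphisms, (f, ξ) satisfies the spectral condition, and Σ_j t_j Tr(ξ_j) = −t_i · dim ker(f_i), which is negative whenever t_i > 0. In particular f is not μ_t-semistable when t_i > 0 for all i. -/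
open LinearMap Module Submodule

noncomputable section

/-- Membership in the filtration. -/
theorem mem_eigFilt_of {V : Type*} [NormedAddCommGroup V] [InnerProductSpace ℂ V]
    (ξ : V →ₗ[ℂ] V) {lam : ℝ} (μ : ℝ) (h : μ ≤ lam) {x : V} (hx : ξ x = (μ : ℂ) • x) :
    x ∈ eigFilt ξ lam := by
  unfold eigFilt
  exact Submodule.mem_iSup_of_mem μ (Submodule.mem_iSup_of_mem h
    (Module.End.mem_eigenspace_iff.2 hx))

/-- Checking inclusion of the filtration on eigenvectors. -/
theorem map_eigFilt_le {V W : Type*} [NormedAddCommGroup V] [InnerProductSpace ℂ V]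
    [NormedAddCommGroup W] [InnerProductSpace ℂ W]
    (ξ : V →ₗ[ℂ] V) (g : V →ₗ[ℂ] W) {lam : ℝ} (S : Submodule ℂ W)
    (h : ∀ μ : ℝ, μ ≤ lam → ∀ x, ξ x = (μ : ℂ) • x → g x ∈ S) :
    (eigFilt ξ lam).map g ≤ S := by
  rw [Submodule.map_le_iff_le_comap]
  unfold eigFilt
  refine iSup_le fun μ => iSup_le fun hμ => fun x hx => ?_
  exact h μ hμ x (Module.End.mem_eigenspace_iff.1 hx)

/-- Minus the orthogonal projection. -/
theorem negProj_apply {V : Type*} [NormedAddCommGroup V] [InnerProductSpace ℂ V]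
    (K : Submodule ℂ V) [K.HasOrthogonalProjection] (x : V) :
    (-(K.subtype ∘ₗ (orthogonalProjection K : V →L[ℂ] K).toLinearMap)) x =
      -(orthogonalProjection K x : V) := rfl

theorem negProj_eigFilt {V : Type*} [NormedAddCommGroup V] [InnerProductSpace ℂ V]
    (K : Submodule ℂ V) [K.HasOrthogonalProjection] {lam : ℝ} (h : 0 ≤ lam) (x : V) :
    x ∈ eigFilt (-(K.subtype ∘ₗ (orthogonalProjection K : V →L[ℂ] K).toLinearMap)) lam := by
  have h1 : (orthogonalProjection K x : V) ∈
      eigFilt (-(K.subtype ∘ₗ (orthogonalProjection K : V →L[ℂ] K).toLinearMap)) lam := by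
    refine mem_eigFilt_of _ (-1) (by linarith) ?_
    have hP : K.starProjection (K.starProjection x) = K.starProjection x :=
      Submodule.starProjection_eq_self_iff.2 (Subtype.mem _)
    rw [negProj_apply]
    simp [hP]
  have h2 : x - (orthogonalProjection K x : V) ∈
      eigFilt (-(K.subtype ∘ₗ (orthogonalProjection K : V →L[ℂ] K).toLinearMap)) lam := by
    refine mem_eigFilt_of _ 0 h ?_
    have hP : K.starProjection (K.starProjection x) = K.starProjection x :=
      Submodule.starProjection_eq_self_iff.2 (Subtype.mem _)
    rw [negProj_apply]
    simp [hP]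
  simpa using add_mem h1 h2

theorem negProj_symm_s5 {V : Type*} [NormedAddCommGroup V] [InnerProductSpace ℂ V]
    (K : Submodule ℂ V) [K.HasOrthogonalProjection] :
    (-(K.subtype ∘ₗ (orthogonalProjection K : V →L[ℂ] K).toLinearMap)).IsSymmetric := by
  intro x y
  rw [negProj_apply, negProj_apply, inner_neg_left, inner_neg_right]
  congr 1
  exact K.starProjection_isSymmetric x y

theorem negProj_trace_s5 {V : Type*} [NormedAddCommGroup V] [InnerProductSpace ℂ V]
    [FiniteDimensional ℂ V] (K : Submodule ℂ V) :
    LinearMap.trace ℂ V (-(K.subtype ∘ₗ (orthogonalProjection K : V →L[ℂ] K).toLinearMap)) =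
      -(finrank ℂ K : ℂ) := by
  rw [map_neg, LinearMap.trace_comp_comm']
  have : (orthogonalProjection K : V →L[ℂ] K).toLinearMap ∘ₗ K.subtype = LinearMap.id := by
    ext x
    simp
  rw [this, LinearMap.trace_id]

/-- If `ker (f i) ≠ 0` for some `i`, then the tuple `ξ` defined by
`ξ_i := −P` (where `P` is the orthogonal projection onto `ker (f i)`) and `ξ_j := 0`
for `j ≠ i` is a nonzero tuple of self-adjoint endomorphisms, `(f, ξ)` satisfies the
spectral condition, and `Σ_j t_j Tr(ξ_j) = −t_i·dim ker(f i)`, which is negative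
whenever `t_i > 0`.  In particular `f` is not `μ_t`-semistable when all `t_i > 0`. -/
theorem not_muSemistable_of_ker_ne_bot {m : ℕ} (hm : 1 ≤ m) {V : Fin (m + 1) → Type*}
    [∀ j, NormedAddCommGroup (V j)] [∀ j, InnerProductSpace ℂ (V j)]
    [∀ j, FiniteDimensional ℂ (V j)]
    (f : ∀ i : Fin m, V i.castSucc →ₗ[ℂ] V i.succ)
    (i : Fin m) (hker : LinearMap.ker (f i) ≠ ⊥)
    (ξ : ∀ j, V j →ₗ[ℂ] V j)
    (hξi : ξ i.castSucc =
      -((LinearMap.ker (f i)).subtype ∘ₗ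
          (orthogonalProjection (LinearMap.ker (f i)) :
            V i.castSucc →L[ℂ] LinearMap.ker (f i)).toLinearMap))
    (hξ0 : ∀ j, j ≠ i.castSucc → ξ j = 0) :
    ξ ≠ 0 ∧ (∀ j, (ξ j).IsSymmetric) ∧ SpectralCond f ξ ∧
      (∀ t : Fin m → ℝ,
        ∑ j : Fin m, t j * (LinearMap.trace ℂ (V j.castSucc) (ξ j.castSucc)).re =
          -(t i * (finrank ℂ (LinearMap.ker (f i)) : ℝ))) ∧
      (∀ t : Fin m → ℝ, 0 < t i →
        ∑ j : Fin m, t j * (LinearMap.trace ℂ (V j.castSucc) (ξ j.castSucc)).re < 0) ∧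
      (∀ t : Fin m → ℝ, (∀ j, 0 < t j) → ¬ MuSemistable t f) := by
  have hlast : ξ (Fin.last m) = 0 := hξ0 _ (Fin.castSucc_lt_last i).ne'
  have hsymm : ∀ j, (ξ j).IsSymmetric := by
    intro j
    by_cases hj : j = i.castSucc
    · subst hj
      rw [hξi]
      exact negProj_symm_s5 _
    · rw [hξ0 j hj]
      intro x y
      simp
  have htop : ∀ j (lam : ℝ), 0 ≤ lam → ∀ x, x ∈ eigFilt (ξ j) lam := by
    intro j lam hl x
    by_cases hj : j = i.castSucc
    · subst hj
      rw [hξi]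
      exact negProj_eigFilt _ hl x
    · rw [hξ0 j hj]
      exact mem_eigFilt_of _ 0 hl (by simp)
  have hspec : SpectralCond f ξ := by
    refine ⟨hlast, fun j lam => map_eigFilt_le _ _ _ fun μ hμ x hx => ?_⟩
    by_cases hl : 0 ≤ lam
    · exact htop _ _ hl _
    · have hμ0 : (μ : ℂ) ≠ 0 := by
        have : μ ≠ 0 := by intro h; exact hl (h ▸ hμ)
        exact_mod_cast this
      have hfx : f j x = 0 := by
        by_cases hj : j = i
        · subst hj
          rw [hξi, negProj_apply] at hx
          have hmem : (μ : ℂ) • x ∈ LinearMap.ker (f j) := by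
            rw [← hx]
            exact neg_mem (Subtype.mem _)
          exact ((Submodule.smul_mem_iff _ hμ0).1 hmem)
        · rw [hξ0 j.castSucc (fun h => hj (Fin.castSucc_injective m h))] at hx
          have : x = 0 := (smul_eq_zero.1 (hx.symm.trans rfl)).resolve_left hμ0
          rw [this, map_zero]
      rw [hfx]
      exact zero_mem _
  have hsum : ∀ t : Fin m → ℝ,
        ∑ j : Fin m, t j * (LinearMap.trace ℂ (V j.castSucc) (ξ j.castSucc)).re =
          -(t i * (finrank ℂ (LinearMap.ker (f i)) : ℝ)) := by
    intro t
    rw [Finset.sum_eq_single i]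
    · rw [hξi, negProj_trace_s5]
      simp
    · intro j _ hj
      rw [hξ0 j.castSucc (fun h => hj (Fin.castSucc_injective m h))]
      simp
    · simp
  have hpos : 0 < finrank ℂ (LinearMap.ker (f i)) :=
    Nat.pos_of_ne_zero fun h => hker (Submodule.finrank_eq_zero.1 h)
  have hneg : ∀ t : Fin m → ℝ, 0 < t i →
        ∑ j : Fin m, t j * (LinearMap.trace ℂ (V j.castSucc) (ξ j.castSucc)).re < 0 := by
    intro t ht
    rw [hsum t, neg_lt_zero]
    exact mul_pos ht (by exact_mod_cast hpos)
  have hne : ξ ≠ 0 := by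
    intro h
    have := hneg (fun _ => 1) one_pos
    simp [h] at this
  exact ⟨hne, hsymm, hspec, hsum, hneg, fun t ht hss =>
    absurd (hss ξ hsymm hspec hne) (not_le.2 (hneg t (ht i)))⟩
end
end

section
/- Let f = (f_1, …, f_m) and f' = (f'_1, …, f'_m) be injective tuples of linear maps f_i, f'_i : V_i → V_{i+1}. Then W_i(f) = W_i(f') for all 1 ≤ i ≤ m if and only if there exist g_i ∈ GL(V_i), 1 ≤ i ≤ m, such that f'_i = g_{i+1} ∘ f_i ∘ g_i⁻¹ for 1 ≤ i ≤ m−1 and f'_m = f_m ∘ g_m⁻¹. That is, the map f ↦ (W_1(f), …, W_m(f)) separates exactly the ∏_{i=1}^m GL(V_i)-orbits of injective tuples. -/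
open LinearMap Module

noncomputable section

/-- The composition `f_m ∘ ⋯ ∘ f_j : V_j → V_{m+1}` (the identity for `j = m+1`). -/
def chainComp {m : ℕ} {V : Fin (m + 1) → Type*} [∀ j, AddCommGroup (V j)]
    [∀ j, Module ℂ (V j)]
    (f : ∀ i : Fin m, V i.castSucc →ₗ[ℂ] V i.succ) :
    ∀ j : Fin (m + 1), V j →ₗ[ℂ] V (Fin.last m) :=
  Fin.reverseInduction LinearMap.id (fun i ih => ih ∘ₗ f i)

/-- `W_i(f) := (f_m ∘ ⋯ ∘ f_i)(V_i) ⊆ V`. -/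
def Wsub {m : ℕ} {V : Fin (m + 1) → Type*} [∀ j, AddCommGroup (V j)]
    [∀ j, Module ℂ (V j)]
    (f : ∀ i : Fin m, V i.castSucc →ₗ[ℂ] V i.succ) (i : Fin m) :
    Submodule ℂ (V (Fin.last m)) :=
  LinearMap.range (chainComp f i.castSucc)

theorem chainComp_last {m : ℕ} {V : Fin (m + 1) → Type*} [∀ j, AddCommGroup (V j)]
    [∀ j, Module ℂ (V j)]
    (f : ∀ i : Fin m, V i.castSucc →ₗ[ℂ] V i.succ) :
    chainComp f (Fin.last m) = LinearMap.id := by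
  unfold chainComp
  exact Fin.reverseInduction_last

theorem chainComp_castSucc {m : ℕ} {V : Fin (m + 1) → Type*} [∀ j, AddCommGroup (V j)]
    [∀ j, Module ℂ (V j)]
    (f : ∀ i : Fin m, V i.castSucc →ₗ[ℂ] V i.succ) (i : Fin m) :
    chainComp f i.castSucc = chainComp f i.succ ∘ₗ f i := by
  unfold chainComp
  exact Fin.reverseInduction_castSucc _

theorem chainComp_injective {m : ℕ} {V : Fin (m + 1) → Type*} [∀ j, AddCommGroup (V j)]
    [∀ j, Module ℂ (V j)]
    (f : ∀ i : Fin m, V i.castSucc →ₗ[ℂ] V i.succ)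
    (hf : ∀ i, Function.Injective (f i)) (j : Fin (m + 1)) :
    Function.Injective (chainComp f j) := by
  induction j using Fin.reverseInduction with
  | last => rw [chainComp_last]; exact Function.injective_id
  | cast i ih =>
    rw [chainComp_castSucc, LinearMap.coe_comp]
    exact ih.comp (hf i)

/-- Two injective tuples `f`, `f'` satisfy `W_i(f) = W_i(f')` for all
`i` iff they lie in the same orbit of `∏_i GL(V_i)`, i.e. iff there are `g_i ∈ GL(V_i)`
with `f'_i = g_{i+1} ∘ f_i ∘ g_i⁻¹` for `1 ≤ i ≤ m−1` and `f'_m = f_m ∘ g_m⁻¹`.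
(The family `g` is encoded with an extra last component `g_{m+1}` required to be the
identity, so the action takes the uniform form `f'_i = g_{i+1} ∘ f_i ∘ g_i⁻¹`.) -/
theorem flags_eq_iff_gl_orbit {m : ℕ} (hm : 1 ≤ m)
    {V : Fin (m + 1) → Type*} [∀ j, AddCommGroup (V j)] [∀ j, Module ℂ (V j)]
    [∀ j, FiniteDimensional ℂ (V j)]
    (f f' : ∀ i : Fin m, V i.castSucc →ₗ[ℂ] V i.succ)
    (hf : ∀ i, Function.Injective (f i)) (hf' : ∀ i, Function.Injective (f' i)) :
    (∀ i : Fin m, Wsub f i = Wsub f' i) ↔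
      ∃ g : ∀ j, V j ≃ₗ[ℂ] V j,
        g (Fin.last m) = LinearEquiv.refl ℂ (V (Fin.last m)) ∧
        ∀ i : Fin m,
          f' i = (g i.succ).toLinearMap ∘ₗ f i ∘ₗ ((g i.castSucc).symm).toLinearMap := by
  constructor
  · intro h
    have hr : ∀ j, LinearMap.range (chainComp f j) = LinearMap.range (chainComp f' j) := by
      intro j
      induction j using Fin.lastCases with
      | last => rw [chainComp_last, chainComp_last]
      | cast i => exact h i
    have hi := chainComp_injective f hf
    have hi' := chainComp_injective f' hf'
    let g : ∀ j, V j ≃ₗ[ℂ] V j := fun j =>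
      (LinearEquiv.ofInjective (chainComp f j) (hi j)).trans
        ((LinearEquiv.ofEq _ _ (hr j)).trans
          (LinearEquiv.ofInjective (chainComp f' j) (hi' j)).symm)
    have hg : ∀ j x, chainComp f' j (g j x) = chainComp f j x := by
      intro j x
      have h1 : LinearEquiv.ofInjective (chainComp f' j) (hi' j) (g j x) =
          LinearEquiv.ofEq _ _ (hr j) (LinearEquiv.ofInjective (chainComp f j) (hi j) x) := by
        simp [g]
      exact congrArg Subtype.val h1
    refine ⟨g, ?_, ?_⟩
    · ext x
      have := hg (Fin.last m) x
      simpa [chainComp_last] using this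
    · intro i
      ext x
      apply hi' i.succ
      have h1 := hg i.castSucc ((g i.castSucc).symm x)
      rw [LinearEquiv.apply_symm_apply, chainComp_castSucc, chainComp_castSucc] at h1
      simp only [LinearMap.comp_apply, LinearEquiv.coe_coe] at h1 ⊢
      rw [h1, hg]
  · rintro ⟨g, hl, hg⟩ i
    have key : ∀ j, chainComp f' j = chainComp f j ∘ₗ ((g j).symm).toLinearMap := by
      intro j
      induction j using Fin.reverseInduction with
      | last => rw [chainComp_last, chainComp_last, hl]; rfl
      | cast i ih =>
        rw [chainComp_castSucc, chainComp_castSucc, ih, hg i]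
        ext x
        simp
    unfold Wsub
    rw [key, LinearMap.range_comp_of_range_eq_top]
    exact LinearEquiv.range _
end
end

section
/- (Theorem 1.4(1)) There exists ε_0 > 0 such that for all ε ∈ (0, ε_0) and every pair of linear maps k, l : U → V the following are equivalent: (a) for all subspaces U_1 ⊆ U and V_1 ⊆ V with (U_1, V_1) ≠ (0, 0) and k(U_1) + l(U_1) ⊆ V_1, one has (1+ε)·dim V_1 > dim U_1; (b) the same condition with the non-strict inequality (1+ε)·dim V_1 ≥ dim U_1; (c) there exists (x, y) ∈ ℂ² such that x·k + y·l : U → V is injective (i.e., x·k + y·l has maximal rank u = dim U for a general pair (x,y)). -/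
open LinearMap Module Submodule

noncomputable section

/-- If `f` has maximal rank in the pencil `f + t l`, then a vector lying in the range of every
`f + t l` with `t ≠ 0` lies in the range of `f`. -/
theorem mem_range_of_max_rank {U V : Type*}
    [NormedAddCommGroup U] [InnerProductSpace ℂ U] [FiniteDimensional ℂ U]
    [NormedAddCommGroup V] [InnerProductSpace ℂ V] [FiniteDimensional ℂ V]
    (f l : U →ₗ[ℂ] V)
    (hmax : ∀ t : ℂ, finrank ℂ (LinearMap.range (f + t • l)) ≤ finrank ℂ (LinearMap.range f))
    (w : V) (hw : ∀ t : ℂ, t ≠ 0 → w ∈ LinearMap.range (f + t • l)) :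
    w ∈ LinearMap.range f := by
  by_contra hwf
  let b := Module.finBasis ℂ (LinearMap.range f)
  have hb : ∀ i, ∃ e : U, f e = (b i : V) := fun i => (b i).2
  choose e he using hb
  let F : ℂ → Fin (finrank ℂ (LinearMap.range f) + 1) → V := fun t =>
    Fin.cons w (fun i => f (e i) + t • l (e i))
  have hF : Continuous F := by
    refine continuous_pi fun i => ?_
    refine Fin.cases ?_ (fun j => ?_) i
    · simp only [F, Fin.cons_zero]; fun_prop
    · simp only [F, Fin.cons_succ]; fun_prop
  have h0 : LinearIndependent ℂ (F 0) := by
    simp only [F, zero_smul, add_zero]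
    rw [linearIndependent_finCons]
    constructor
    · simp only [he]
      exact b.linearIndependent.map' (LinearMap.range f).subtype (Submodule.ker_subtype _)
    · intro hmem
      refine hwf (Submodule.span_le.2 ?_ hmem)
      rintro _ ⟨i, rfl⟩
      exact ⟨e i, rfl⟩
  have hopen : IsOpen {t : ℂ | LinearIndependent ℂ (F t)} :=
    isOpen_setOfPred_linearIndependent.preimage hF
  have hev : ∀ᶠ t in nhdsWithin (0 : ℂ) {0}ᶜ, LinearIndependent ℂ (F t) :=
    nhdsWithin_le_nhds (hopen.mem_nhds h0)
  obtain ⟨t, ht, ht0⟩ := (hev.and self_mem_nhdsWithin).exists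
  have h1 := finrank_span_eq_card ht
  have h2 : Submodule.span ℂ (Set.range (F t)) ≤ LinearMap.range (f + t • l) := by
    refine Submodule.span_le.2 ?_
    rintro _ ⟨i, rfl⟩
    refine Fin.cases ?_ (fun j => ?_) i
    · exact hw t ht0
    · exact ⟨e j, by simp [F]⟩
  have h3 := Submodule.finrank_mono h2
  have h4 := hmax t
  simp only [Fintype.card_fin] at h1
  omega

/-- Non-strict dimension condition implies that some member of the pencil is injective. -/
theorem exists_injective_of_dim {U V : Type*}
    [NormedAddCommGroup U] [InnerProductSpace ℂ U] [FiniteDimensional ℂ U]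
    [NormedAddCommGroup V] [InnerProductSpace ℂ V] [FiniteDimensional ℂ V]
    (k l : U →ₗ[ℂ] V)
    (h : ∀ (U₁ : Submodule ℂ U) (V₁ : Submodule ℂ V), ¬(U₁ = ⊥ ∧ V₁ = ⊥) →
      U₁.map k ⊔ U₁.map l ≤ V₁ → finrank ℂ U₁ ≤ finrank ℂ V₁) :
    ∃ x y : ℂ, Function.Injective ⇑(x • k + y • l) := by
  obtain ⟨t, ht⟩ : ∃ t : ℂ, ∀ s : ℂ,
      finrank ℂ (LinearMap.range (k + s • l)) ≤ finrank ℂ (LinearMap.range (k + t • l)) := by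
    have hfin : (Set.range fun s : ℂ => finrank ℂ (LinearMap.range (k + s • l))).Finite :=
      (Set.finite_Iic (finrank ℂ V)).subset (by
        rintro _ ⟨s, rfl⟩
        exact Submodule.finrank_le _)
    obtain ⟨_, ⟨t, rfl⟩, ht⟩ := hfin.exists_maximal (Set.range_nonempty _)
    refine ⟨t, fun s => ?_⟩
    by_contra hlt
    exact hlt (ht ⟨s, rfl⟩ (not_le.1 hlt).le)
  refine ⟨1, t, ?_⟩
  rw [one_smul]
  set f := k + t • l with hf
  have hmax : ∀ s : ℂ,
      finrank ℂ (LinearMap.range (f + s • l)) ≤ finrank ℂ (LinearMap.range f) := by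
    intro s
    have : f + s • l = k + (t + s) • l := by rw [hf, add_smul, add_assoc]
    rw [this]
    exact ht _
  let N : Submodule ℂ V := ⨅ s : {s : ℂ // s ≠ 0}, LinearMap.range (f + s.1 • l)
  have hNf : N ≤ LinearMap.range f := fun w hw =>
    mem_range_of_max_rank f l hmax w fun s hs => (Submodule.mem_iInf _).1 hw ⟨s, hs⟩
  have hl : ∀ u : U, f u ∈ N → l u ∈ N := by
    intro u hu
    refine (Submodule.mem_iInf _).2 ?_
    rintro ⟨s, hs⟩
    have h1 : f u ∈ LinearMap.range (f + s • l) := (Submodule.mem_iInf _).1 hu ⟨s, hs⟩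
    have h2 : (f + s • l) u - f u ∈ LinearMap.range (f + s • l) :=
      Submodule.sub_mem _ ⟨u, rfl⟩ h1
    have h3 : l u = s⁻¹ • ((f + s • l) u - f u) := by
      simp [smul_smul, inv_mul_cancel₀ hs]
    rw [h3]
    exact Submodule.smul_mem _ _ h2
  have hk : ∀ u : U, f u ∈ N → k u ∈ N := by
    intro u hu
    have : k u = f u - t • l u := by simp [hf]
    rw [this]
    exact N.sub_mem hu (N.smul_mem _ (hl u hu))
  by_contra hinj
  have hker : LinearMap.ker f ≠ ⊥ := fun h0 => hinj (LinearMap.ker_eq_bot.1 h0)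
  have hle : LinearMap.ker f ≤ N.comap f := by
    intro u hu
    rw [Submodule.mem_comap, LinearMap.mem_ker.1 hu]
    exact N.zero_mem
  have hdim := h (N.comap f) N (fun h0 => hker (le_bot_iff.1 (h0.1 ▸ hle))) (by
    refine sup_le ?_ ?_
    · rintro _ ⟨u, hu, rfl⟩
      exact hk u hu
    · rintro _ ⟨u, hu, rfl⟩
      exact hl u hu)
  let g : N.comap f →ₗ[ℂ] V := f.domRestrict (N.comap f)
  have hrange : LinearMap.range g = N := by
    ext w
    constructor
    · rintro ⟨u, rfl⟩
      exact u.2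
    · intro hw
      obtain ⟨u, rfl⟩ := hNf hw
      exact ⟨⟨u, hw⟩, rfl⟩
  have hrn := LinearMap.finrank_range_add_finrank_ker g
  rw [hrange] at hrn
  have hg0 : finrank ℂ (LinearMap.ker g) = 0 := by omega
  have hgb : LinearMap.ker g = ⊥ := Submodule.finrank_eq_zero.1 hg0
  apply hker
  rw [eq_bot_iff]
  intro u hu
  have : (⟨u, hle hu⟩ : N.comap f) ∈ LinearMap.ker g := LinearMap.mem_ker.1 hu
  rw [hgb, Submodule.mem_bot] at this
  exact congrArg Subtype.val this

/-- **Theorem 1.4(1).** There is `ε₀ > 0` so that for all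
`ε ∈ (0, ε₀)` and all linear maps `k, l : U → V`, the following are equivalent:
(a) for all `U₁ ⊆ U`, `V₁ ⊆ V` with `(U₁,V₁) ≠ (0,0)` and `k(U₁) + l(U₁) ⊆ V₁`, one
has `(1+ε)·dim V₁ > dim U₁`; (b) the same with `(1+ε)·dim V₁ ≥ dim U₁`; (c) `x·k + y·l`
is injective for some `(x, y) ∈ ℂ²` (i.e. for a general pair `(x, y)`). -/
theorem first_stability_iff_generic_injective
    {U V W : Type*}
    [NormedAddCommGroup U] [InnerProductSpace ℂ U] [FiniteDimensional ℂ U]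
    [NormedAddCommGroup V] [InnerProductSpace ℂ V] [FiniteDimensional ℂ V]
    [NormedAddCommGroup W] [InnerProductSpace ℂ W] [FiniteDimensional ℂ W]
    (r : ℕ) (hdim : finrank ℂ V = finrank ℂ U + r) (hrw : r ≤ finrank ℂ W) :
    ∃ ε₀ : ℝ, 0 < ε₀ ∧ ∀ ε : ℝ, 0 < ε → ε < ε₀ → ∀ k l : U →ₗ[ℂ] V,
      ((∀ (U₁ : Submodule ℂ U) (V₁ : Submodule ℂ V), ¬(U₁ = ⊥ ∧ V₁ = ⊥) →
          U₁.map k ⊔ U₁.map l ≤ V₁ →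
          (finrank ℂ U₁ : ℝ) < (1 + ε) * (finrank ℂ V₁ : ℝ)) ↔
        (∃ x y : ℂ, Function.Injective ⇑(x • k + y • l))) ∧
      ((∀ (U₁ : Submodule ℂ U) (V₁ : Submodule ℂ V), ¬(U₁ = ⊥ ∧ V₁ = ⊥) →
          U₁.map k ⊔ U₁.map l ≤ V₁ →
          (finrank ℂ U₁ : ℝ) ≤ (1 + ε) * (finrank ℂ V₁ : ℝ)) ↔
        (∃ x y : ℂ, Function.Injective ⇑(x • k + y • l))) := by
  have hc : ∀ ε : ℝ, 0 < ε → ∀ k l : U →ₗ[ℂ] V,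
      (∃ x y : ℂ, Function.Injective ⇑(x • k + y • l)) →
      ∀ (U₁ : Submodule ℂ U) (V₁ : Submodule ℂ V), ¬(U₁ = ⊥ ∧ V₁ = ⊥) →
          U₁.map k ⊔ U₁.map l ≤ V₁ →
          (finrank ℂ U₁ : ℝ) < (1 + ε) * (finrank ℂ V₁ : ℝ) := by
    rintro ε hε k l ⟨x, y, hxy⟩ U₁ V₁ hne hle
    have h1 : U₁.map (x • k + y • l) ≤ V₁ := by
      rintro _ ⟨u, hu, rfl⟩
      exact V₁.add_mem (V₁.smul_mem _ (hle (Submodule.mem_sup_left ⟨u, hu, rfl⟩)))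
        (V₁.smul_mem _ (hle (Submodule.mem_sup_right ⟨u, hu, rfl⟩)))
    have h2 := Submodule.finrank_mono h1
    rw [(Submodule.equivMapOfInjective _ hxy U₁).finrank_eq.symm] at h2
    have h3 : 0 < finrank ℂ V₁ := by
      by_contra h0
      exact hne ⟨Submodule.finrank_eq_zero.1 (by omega), Submodule.finrank_eq_zero.1 (by omega)⟩
    have h2' : (finrank ℂ U₁ : ℝ) ≤ finrank ℂ V₁ := by exact_mod_cast h2
    have h3' : (0 : ℝ) < finrank ℂ V₁ := by exact_mod_cast h3
    nlinarith [mul_pos hε h3']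
  have hb : ∀ ε : ℝ, 0 < ε → ε < 1 / ((finrank ℂ V : ℝ) + 1) → ∀ k l : U →ₗ[ℂ] V,
      (∀ (U₁ : Submodule ℂ U) (V₁ : Submodule ℂ V), ¬(U₁ = ⊥ ∧ V₁ = ⊥) →
          U₁.map k ⊔ U₁.map l ≤ V₁ →
          (finrank ℂ U₁ : ℝ) ≤ (1 + ε) * (finrank ℂ V₁ : ℝ)) →
      ∃ x y : ℂ, Function.Injective ⇑(x • k + y • l) := by
    intro ε hε hε' k l h
    refine exists_injective_of_dim k l fun U₁ V₁ hne hle => ?_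
    have h1 := h U₁ V₁ hne hle
    have h2 : (finrank ℂ V₁ : ℝ) ≤ finrank ℂ V := by exact_mod_cast Submodule.finrank_le V₁
    rw [lt_div_iff₀ (by positivity)] at hε'
    have h3 : ε * (finrank ℂ V₁ : ℝ) ≤ ε * finrank ℂ V := mul_le_mul_of_nonneg_left h2 hε.le
    have h4 : (finrank ℂ U₁ : ℝ) < finrank ℂ V₁ + 1 := by nlinarith
    have h5 : finrank ℂ U₁ < finrank ℂ V₁ + 1 := by exact_mod_cast h4
    omega
  refine ⟨1 / ((finrank ℂ V : ℝ) + 1), by positivity, fun ε hε hε' k l => ⟨⟨fun h => ?_, ?_⟩,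
    ⟨hb ε hε hε' k l, fun h U₁ V₁ hne hle => (hc ε hε k l h U₁ V₁ hne hle).le⟩⟩⟩
  · exact hb ε hε hε' k l fun U₁ V₁ hne hle => (h U₁ V₁ hne hle).le
  · exact hc ε hε k l
end
end

section
/- (Theorem 1.4(2)) There exists ε_0 > 0 such that for all ε ∈ (0, ε_0) and every triple of linear maps k, l : U → V, m : W → V the following are equivalent: (a) for all subspaces U_1 ⊆ U and V_1 ⊆ V with (U_1, V_1) ≠ (U, V), k(U_1) + l(U_1) ⊆ V_1, and range(m) ⊆ V_1, one has dim(U/U_1) > (1+ε)·dim(V/V_1); (b) the same condition with the non-strict inequality dim(U/U_1) ≥ (1+ε)·dim(V/V_1); (c) for every (x, y) ∈ ℂ² \ {(0,0)}, the linear map U ⊕ W → V, (ζ, η) ↦ (x·k + y·l)(ζ) + m(η), is surjective (i.e., the matrix [x·k + y·l | m] has maximal rank v = dim V for all (x,y) ≠ (0,0)). -/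
open LinearMap Module Submodule

noncomputable section

theorem aux_pencil {P Q : Type*} [AddCommGroup P] [Module ℂ P] [FiniteDimensional ℂ P]
    [AddCommGroup Q] [Module ℂ Q] [FiniteDimensional ℂ Q] [Nontrivial Q]
    (f g : P →ₗ[ℂ] Q)
    (h : ∀ x y : ℂ, ¬(x = 0 ∧ y = 0) → Function.Surjective ⇑(x • f + y • g)) :
    finrank ℂ Q < finrank ℂ P := by
  have hf : Function.Surjective f := by simpa using h 1 0 (by simp)
  have hle : finrank ℂ Q ≤ finrank ℂ P := LinearMap.finrank_le_finrank_of_surjective hf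
  refine lt_of_le_of_ne hle fun heq => ?_
  have hinj := (LinearMap.injective_iff_surjective_of_finrank_eq_finrank heq.symm (f := f)).2 hf
  let e := LinearEquiv.ofBijective f ⟨hinj, hf⟩
  haveI : Nontrivial P := hf.nontrivial
  obtain ⟨c, hc⟩ := Module.End.exists_eigenvalue (K := ℂ) (e.symm.toLinearMap ∘ₗ g)
  obtain ⟨v, hv⟩ := hc.exists_hasEigenvector
  have h1 : e.symm (g v) = c • v := hv.apply_eq_smul
  have h2 : g v = c • f v := by
    have := congrArg e h1
    rw [LinearEquiv.apply_symm_apply, map_smul] at this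
    exact this
  have h3 := (LinearMap.injective_iff_surjective_of_finrank_eq_finrank heq.symm
    (f := (-c) • f + (1 : ℂ) • g)).2 (h (-c) 1 (by simp))
  apply hv.2
  apply h3
  simp [h2]

theorem aux_comap {U V : Type*} [AddCommGroup U] [Module ℂ U] [FiniteDimensional ℂ U]
    [AddCommGroup V] [Module ℂ V] [FiniteDimensional ℂ V]
    (f : U →ₗ[ℂ] V) (V₁ : Submodule ℂ V) :
    finrank ℂ (U ⧸ V₁.comap f) ≤ finrank ℂ (V ⧸ V₁) := by
  apply LinearMap.finrank_le_finrank_of_injective (f := (V₁.comap f).mapQ V₁ f le_rfl)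
  rw [← LinearMap.ker_eq_bot, Submodule.ker_mapQ, Submodule.mkQ_map_self]

theorem aux_forward {U V W : Type*} [AddCommGroup U] [Module ℂ U] [FiniteDimensional ℂ U]
    [AddCommGroup V] [Module ℂ V] [FiniteDimensional ℂ V] [AddCommGroup W] [Module ℂ W]
    (ε : ℝ) (hε : 0 < ε) (hε' : ε < 1 / ((finrank ℂ V : ℝ) + 1))
    (k l : U →ₗ[ℂ] V) (m : W →ₗ[ℂ] V)
    (h : ∀ x y : ℂ, ¬(x = 0 ∧ y = 0) → Function.Surjective ⇑((x • k + y • l).coprod m))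
    (U₁ : Submodule ℂ U) (V₁ : Submodule ℂ V) (hne : ¬(U₁ = ⊤ ∧ V₁ = ⊤))
    (hkl : U₁.map k ⊔ U₁.map l ≤ V₁) (hm : LinearMap.range m ≤ V₁) :
    (1 + ε) * (finrank ℂ (V ⧸ V₁) : ℝ) < (finrank ℂ (U ⧸ U₁) : ℝ) := by
  have hk : U₁ ≤ V₁.comap k := Submodule.map_le_iff_le_comap.1 (le_sup_left.trans hkl)
  have hl : U₁ ≤ V₁.comap l := Submodule.map_le_iff_le_comap.1 (le_sup_right.trans hkl)
  by_cases hV : V₁ = ⊤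
  · have hU : U₁ ≠ ⊤ := fun hU => hne ⟨hU, hV⟩
    haveI : Nontrivial (U ⧸ U₁) := Submodule.Quotient.nontrivial_iff.2 hU
    have h0 : finrank ℂ (V ⧸ V₁) = 0 := by
      haveI : Subsingleton (V ⧸ V₁) := Submodule.Quotient.subsingleton_iff.2 hV
      exact finrank_zero_of_subsingleton
    rw [h0]
    have : 0 < finrank ℂ (U ⧸ U₁) := finrank_pos
    simpa using this
  · haveI : Nontrivial (V ⧸ V₁) := Submodule.Quotient.nontrivial_iff.2 hV
    have key := aux_pencil (U₁.mapQ V₁ k hk) (U₁.mapQ V₁ l hl) (by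
      intro x y hxy q
      obtain ⟨q, rfl⟩ := V₁.mkQ_surjective q
      obtain ⟨⟨a, b⟩, hab⟩ := h x y hxy q
      refine ⟨U₁.mkQ a, ?_⟩
      have hb : V₁.mkQ (m b) = 0 := by
        rw [Submodule.mkQ_apply, Submodule.Quotient.mk_eq_zero]
        exact hm ⟨b, rfl⟩
      rw [← hab, LinearMap.coprod_apply, map_add, hb]
      simp)
    have h1 : (finrank ℂ (V ⧸ V₁) : ℝ) + 1 ≤ finrank ℂ (U ⧸ U₁) := by exact_mod_cast key
    have h2 : (finrank ℂ (V ⧸ V₁) : ℝ) ≤ finrank ℂ V := by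
      exact_mod_cast Submodule.finrank_quotient_le V₁
    have h3 : ε * ((finrank ℂ V : ℝ) + 1) < 1 := by
      rwa [lt_div_iff₀ (by positivity)] at hε'
    nlinarith

theorem aux_backward {U V W : Type*} [AddCommGroup U] [Module ℂ U] [FiniteDimensional ℂ U]
    [AddCommGroup V] [Module ℂ V] [FiniteDimensional ℂ V] [AddCommGroup W] [Module ℂ W]
    (ε : ℝ) (hε : 0 < ε)
    (k l : U →ₗ[ℂ] V) (m : W →ₗ[ℂ] V)
    (h : ∀ (U₁ : Submodule ℂ U) (V₁ : Submodule ℂ V), ¬(U₁ = ⊤ ∧ V₁ = ⊤) →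
          U₁.map k ⊔ U₁.map l ≤ V₁ → LinearMap.range m ≤ V₁ →
          (1 + ε) * (finrank ℂ (V ⧸ V₁) : ℝ) ≤ (finrank ℂ (U ⧸ U₁) : ℝ))
    (x y : ℂ) (hxy : ¬(x = 0 ∧ y = 0)) :
    Function.Surjective ⇑((x • k + y • l).coprod m) := by
  rw [← LinearMap.range_eq_top]
  by_contra hV
  set V₁ := LinearMap.range ((x • k + y • l).coprod m) with hV₁
  have hm : LinearMap.range m ≤ V₁ := by
    rintro _ ⟨b, rfl⟩
    exact ⟨(0, b), by simp⟩
  have hs : ∀ a, x • k a + y • l a ∈ V₁ := fun a => ⟨(a, 0), by simp⟩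
  haveI : Nontrivial (V ⧸ V₁) := Submodule.Quotient.nontrivial_iff.2 hV
  have hpos : (0 : ℝ) < finrank ℂ (V ⧸ V₁) := by
    exact_mod_cast (finrank_pos : 0 < finrank ℂ (V ⧸ V₁))
  have fin : ∀ f : U →ₗ[ℂ] V,
      (V₁.comap f).map k ⊔ (V₁.comap f).map l ≤ V₁ → False := by
    intro f hf
    have h1 := h _ V₁ (fun hh => hV hh.2) hf hm
    have h2 : (finrank ℂ (U ⧸ V₁.comap f) : ℝ) ≤ finrank ℂ (V ⧸ V₁) := by
      exact_mod_cast aux_comap f V₁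
    nlinarith
  by_cases hx : x = 0
  · have hy : y ≠ 0 := fun hy => hxy ⟨hx, hy⟩
    refine fin k (sup_le (Submodule.map_comap_le _ _) ?_)
    rintro _ ⟨a, ha, rfl⟩
    have h1 := V₁.sub_mem (hs a) (V₁.smul_mem x ha)
    rw [add_sub_cancel_left] at h1
    exact (V₁.smul_mem_iff hy).1 h1
  · refine fin l (sup_le ?_ (Submodule.map_comap_le _ _))
    rintro _ ⟨a, ha, rfl⟩
    have h1 := V₁.sub_mem (hs a) (V₁.smul_mem y ha)
    rw [add_sub_cancel_right] at h1
    exact (V₁.smul_mem_iff hx).1 h1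

/-- **Theorem 1.4(2).** There is `ε₀ > 0` so that for all
`ε ∈ (0, ε₀)` and all linear maps `k, l : U → V`, `m : W → V`, the following are
equivalent: (a) for all `U₁ ⊆ U`, `V₁ ⊆ V` with `(U₁,V₁) ≠ (U,V)`,
`k(U₁) + l(U₁) ⊆ V₁` and `range m ⊆ V₁`, one has `dim(U/U₁) > (1+ε)·dim(V/V₁)`;
(b) the same with `≥`; (c) for every `(x,y) ≠ (0,0)`, the map
`U ⊕ W → V, (ζ,η) ↦ (x·k + y·l)(ζ) + m(η)` is surjective. -/
theorem second_stability_iff_surjective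
    {U V W : Type*}
    [NormedAddCommGroup U] [InnerProductSpace ℂ U] [FiniteDimensional ℂ U]
    [NormedAddCommGroup V] [InnerProductSpace ℂ V] [FiniteDimensional ℂ V]
    [NormedAddCommGroup W] [InnerProductSpace ℂ W] [FiniteDimensional ℂ W]
    (r : ℕ) (hdim : finrank ℂ V = finrank ℂ U + r) (hrw : r ≤ finrank ℂ W) :
    ∃ ε₀ : ℝ, 0 < ε₀ ∧ ∀ ε : ℝ, 0 < ε → ε < ε₀ →
      ∀ (k l : U →ₗ[ℂ] V) (m : W →ₗ[ℂ] V),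
      ((∀ (U₁ : Submodule ℂ U) (V₁ : Submodule ℂ V), ¬(U₁ = ⊤ ∧ V₁ = ⊤) →
          U₁.map k ⊔ U₁.map l ≤ V₁ → LinearMap.range m ≤ V₁ →
          (1 + ε) * (finrank ℂ (V ⧸ V₁) : ℝ) < (finrank ℂ (U ⧸ U₁) : ℝ)) ↔
        (∀ x y : ℂ, ¬(x = 0 ∧ y = 0) →
          Function.Surjective ⇑((x • k + y • l).coprod m))) ∧
      ((∀ (U₁ : Submodule ℂ U) (V₁ : Submodule ℂ V), ¬(U₁ = ⊤ ∧ V₁ = ⊤) →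
          U₁.map k ⊔ U₁.map l ≤ V₁ → LinearMap.range m ≤ V₁ →
          (1 + ε) * (finrank ℂ (V ⧸ V₁) : ℝ) ≤ (finrank ℂ (U ⧸ U₁) : ℝ)) ↔
        (∀ x y : ℂ, ¬(x = 0 ∧ y = 0) →
          Function.Surjective ⇑((x • k + y • l).coprod m))) := by
  refine ⟨1 / ((finrank ℂ V : ℝ) + 1), by positivity, ?_⟩
  intro ε hε hε' k l m
  refine ⟨⟨fun h => ?_, fun h => ?_⟩, ⟨fun h => ?_, fun h => ?_⟩⟩
  · exact aux_backward ε hε k l m fun U₁ V₁ h1 h2 h3 => (h U₁ V₁ h1 h2 h3).le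
  · exact aux_forward ε hε hε' k l m h
  · exact aux_backward ε hε k l m h
  · exact fun U₁ V₁ h1 h2 h3 => (aux_forward ε hε hε' k l m h U₁ V₁ h1 h2 h3).le
end
end

section
/- (Freeness part of Strømme's Theorem 1.5) Let (k, l, m) be a Strømme triple, i.e. x·k + y·l is injective for some (x,y) ∈ ℂ² and for every (x,y) ∈ ℂ² \ {(0,0)} the map U ⊕ W → V, (ζ, η) ↦ (x·k + y·l)(ζ) + m(η), is surjective. If a ∈ GL(U) and b ∈ GL(V) satisfy b ∘ k = k ∘ a, b ∘ l = l ∘ a, and b ∘ m = m, then a = id_U and b = id_V. In other words, the group GL(U) × GL(V) acts freely on the set of Strømme triples via (a,b)·(k,l,m) = (b∘k∘a⁻¹, b∘l∘a⁻¹, b∘m). -/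
open LinearMap Module

noncomputable section

/-- `(k,l,m)` is a Strømme triple: `x·k + y·l` is injective for some `(x,y) ∈ ℂ²`, and
for every `(x,y) ≠ (0,0)` the map `U ⊕ W → V, (ζ,η) ↦ (x·k + y·l)(ζ) + m(η)` is
surjective. -/
def IsStrommeTriple {U V W : Type*} [AddCommGroup U] [Module ℂ U]
    [AddCommGroup V] [Module ℂ V] [AddCommGroup W] [Module ℂ W]
    (k l : U →ₗ[ℂ] V) (m : W →ₗ[ℂ] V) : Prop :=
  (∃ x y : ℂ, Function.Injective ⇑(x • k + y • l)) ∧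
  (∀ x y : ℂ, ¬(x = 0 ∧ y = 0) → Function.Surjective ⇑((x • k + y • l).coprod m))

/-- A pencil of square linear maps over `ℂ` all of whose members `q - μ p` are surjective,
with `p` bijective, lives on the zero space. -/
theorem pencil_subsingleton {X Y : Type*} [AddCommGroup X] [Module ℂ X] [FiniteDimensional ℂ X]
    [AddCommGroup Y] [Module ℂ Y]
    (p q : X →ₗ[ℂ] Y) (hp : Function.Bijective p)
    (hq : ∀ μ : ℂ, Function.Surjective (q - μ • p)) : Subsingleton X := by
  by_contra hX
  rw [not_subsingleton_iff_nontrivial] at hX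
  let e := LinearEquiv.ofBijective p hp
  let T : Module.End ℂ X := e.symm.toLinearMap ∘ₗ q
  obtain ⟨μ, hμ⟩ := Module.End.exists_eigenvalue T
  obtain ⟨v, hv⟩ := hμ.exists_hasEigenvector
  have h1 : e.symm (q v) = μ • v := hv.apply_eq_smul
  have h2 : q v = μ • p v := by
    have := congrArg e h1
    rw [LinearEquiv.apply_symm_apply, map_smul] at this
    exact this
  have hs : Function.Surjective (e.symm.toLinearMap ∘ₗ (q - μ • p)) := by
    rw [LinearMap.coe_comp]
    exact e.symm.surjective.comp (hq μ)
  have hi := LinearMap.injective_iff_surjective.mpr hs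
  apply hv.2
  apply hi
  simp [h2]

/-- The images of `a - 1` and `b - 1` vanish for a Strømme triple fixed by `(a, b)`. -/
theorem stromme_aux {U V W : Type*} [AddCommGroup U] [Module ℂ U] [FiniteDimensional ℂ U]
    [AddCommGroup V] [Module ℂ V] [AddCommGroup W] [Module ℂ W]
    (k l : U →ₗ[ℂ] V) (m : W →ₗ[ℂ] V) (hkl : IsStrommeTriple k l m)
    (A : U →ₗ[ℂ] U) (B : V →ₗ[ℂ] V)
    (hk : ∀ u, B (k u) = k (A u)) (hl : ∀ u, B (l u) = l (A u)) (hm : ∀ w, B (m w) = 0) :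
    A = 0 ∧ B = 0 := by
  obtain ⟨⟨x, y, hinj⟩, hsur⟩ := hkl
  have hcomm : ∀ (s t : ℂ) (u : U), B ((s • k + t • l) u) = (s • k + t • l) (A u) := by
    intro s t u
    simp [hk, hl]
  have hmaps : ∀ (s t : ℂ), ∀ z ∈ range A, (s • k + t • l) z ∈ range B := by
    rintro s t _ ⟨u, rfl⟩
    exact ⟨_, hcomm s t u⟩
  have hrs : ∀ (s t : ℂ), ¬(s = 0 ∧ t = 0) →
      ∀ v, ∃ u, (s • k + t • l) (A u) = B v := by
    intro s t hst v
    obtain ⟨⟨u, w⟩, rfl⟩ := hsur s t hst v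
    refine ⟨u, ?_⟩
    rw [← hcomm, LinearMap.coprod_apply, map_add, hm, add_zero]
  have hrs' : ∀ (s t : ℂ), ¬(s = 0 ∧ t = 0) →
      Function.Surjective ((s • k + t • l).restrict (hmaps s t)) := by
    rintro s t hst ⟨_, v, rfl⟩
    obtain ⟨u, hu⟩ := hrs s t hst v
    exact ⟨⟨A u, u, rfl⟩, Subtype.ext hu⟩
  have hA : A = 0 := by
    by_cases hxy : x = 0 ∧ y = 0
    · ext u
      apply hinj
      simp [hxy.1, hxy.2]
    have hbij : Function.Bijective ((x • k + y • l).restrict (hmaps x y)) := by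
      refine ⟨?_, hrs' x y hxy⟩
      intro z z' h
      exact Subtype.ext (hinj (congrArg Subtype.val h))
    have hsub : Subsingleton (range A) := by
      by_cases hx : x = 0
      · refine pencil_subsingleton _ ((((1 : ℂ) • k + (0 : ℂ) • l)).restrict (hmaps 1 0)) hbij ?_
        intro μ
        have h := hrs' (1 - μ * x) (0 - μ * y) (by simp [hx])
        convert h using 2
        ext z
        simp [hx, sub_eq_add_neg, mul_smul]
      · refine pencil_subsingleton _ ((((0 : ℂ) • k + (1 : ℂ) • l)).restrict (hmaps 0 1)) hbij ?_
        intro μ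
        have h := hrs' (0 - μ * x) (1 - μ * y) (by
          rintro ⟨h1, h2⟩
          have : μ = 0 := by simpa [hx] using h1
          simp [this] at h2)
        convert h using 2
        ext z
        simp [sub_smul, mul_smul]
        abel
    rw [← LinearMap.range_eq_bot]
    exact (Submodule.subsingleton_iff_eq_bot).mp hsub
  refine ⟨hA, ?_⟩
  ext v
  obtain ⟨u, hu⟩ := hrs 1 0 (by simp) v
  rw [← hu, hA]
  simp

/-- **freeness part of Strømme's Theorem 1.5.** If `(k,l,m)` is a
Strømme triple and `a ∈ GL(U)`, `b ∈ GL(V)` satisfy `b∘k = k∘a`, `b∘l = l∘a` and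
`b∘m = m`, then `a = id` and `b = id`: the group `GL(U) × GL(V)` acts freely on the
set of Strømme triples. -/
theorem gl_action_free_on_stromme_triples
    {U V W : Type*} [AddCommGroup U] [Module ℂ U] [FiniteDimensional ℂ U]
    [AddCommGroup V] [Module ℂ V] [FiniteDimensional ℂ V]
    [AddCommGroup W] [Module ℂ W] [FiniteDimensional ℂ W]
    (r : ℕ) (hdim : finrank ℂ V = finrank ℂ U + r) (hrw : r ≤ finrank ℂ W)
    (k l : U →ₗ[ℂ] V) (m : W →ₗ[ℂ] V) (hkl : IsStrommeTriple k l m)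
    (a : U ≃ₗ[ℂ] U) (b : V ≃ₗ[ℂ] V)
    (hk : b.toLinearMap ∘ₗ k = k ∘ₗ a.toLinearMap)
    (hl : b.toLinearMap ∘ₗ l = l ∘ₗ a.toLinearMap)
    (hm : b.toLinearMap ∘ₗ m = m) :
    a = LinearEquiv.refl ℂ U ∧ b = LinearEquiv.refl ℂ V := by
  have h := stromme_aux k l m hkl (a.toLinearMap - LinearMap.id) (b.toLinearMap - LinearMap.id)
    (fun u => by simpa using LinearMap.congr_fun hk u)
    (fun u => by simpa using LinearMap.congr_fun hl u)
    (fun w => by simpa [sub_eq_zero] using LinearMap.congr_fun hm w)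
  constructor
  · ext u
    have := LinearMap.congr_fun h.1 u
    simpa [sub_eq_zero] using this
  · ext v
    have := LinearMap.congr_fun h.2 v
    simpa [sub_eq_zero] using this
end
end
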